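/- For every a ∈ (0, 0.45), the function η(y,z) = H(ay)H(az), with H(x) = tanh(x/√2), satisfies the subsolution inequality -∂_y²η - ∂_z²η - (6/(y²-z²))(y∂_yη - z∂_zη) - η + η³ ≤ 0 in the region {y > z > 0}. -/

import Mathlib

noncomputable def H : ℝ → ℝ := fun x => Real.tanh (x / Real.sqrt 2)

theorem hasDerivAt_tanh_aux (x : ℝ) : HasDerivAt Real.tanh (1 - Real.tanh x ^ 2) x := by
  have hc := (Real.cosh_pos x).ne'
  have h := (Real.hasDerivAt_sinh x).div (Real.hasDerivAt_cosh x) hc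
  have he : Real.tanh = fun t => Real.sinh t / Real.cosh t := by
    funext t; exact Real.tanh_eq_sinh_div_cosh t
  rw [he]
  refine h.congr_deriv ?_
  simp only []
  field_simp

theorem hasDerivAt_H_aux (a x : ℝ) :
    HasDerivAt (fun t => H (a * t)) (a / Real.sqrt 2 * (1 - H (a * x) ^ 2)) x := by
  have h1 : HasDerivAt (fun t : ℝ => a * t / Real.sqrt 2) (a / Real.sqrt 2) x := by
    have := ((hasDerivAt_id x).const_mul a).div_const (Real.sqrt 2)
    simpa using this
  have h2 := (hasDerivAt_tanh_aux (a * x / Real.sqrt 2)).comp x h1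
  refine h2.congr_deriv ?_
  simp only [H]; ring

theorem deriv2_H_aux (a c x : ℝ) :
    deriv (fun x1 => deriv (fun x2 => H (a * x2) * c) x1) x
      = -(a ^ 2 * H (a * x) * (1 - H (a * x) ^ 2)) * c := by
  have h1 : (fun x1 => deriv (fun x2 => H (a * x2) * c) x1)
      = fun x1 => a / Real.sqrt 2 * (1 - H (a * x1) ^ 2) * c := by
    funext x1; exact ((hasDerivAt_H_aux a x1).mul_const c).deriv
  rw [h1]
  have h2 := ((((hasDerivAt_H_aux a x).pow 2).const_sub 1).const_mul (a / Real.sqrt 2)).mul_const c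
  have h3 := h2.deriv
  simp only [Pi.pow_apply] at h3
  rw [h3]
  have hs : Real.sqrt 2 ^ 2 = 2 := Real.sq_sqrt (by norm_num)
  have hs0 : Real.sqrt 2 ≠ 0 := by positivity
  field_simp
  rw [hs]
  norm_num
  try ring

theorem sc_aux (t : ℝ) (ht : 0 < t) :
    t * (Real.cosh t ^ 2 + Real.sinh t ^ 2 / 2) ≤ Real.sinh t * Real.cosh t * Real.cosh t ^ 2 := by
  have hS : t ≤ Real.sinh t := Real.self_le_sinh_iff.2 ht.le
  have hC : 1 ≤ Real.cosh t := Real.one_le_cosh t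
  have h := Real.cosh_sq t
  -- C ^ 3 ≥ C ^ 2 + S ^ 2 / 2
  have h3 : Real.cosh t ^ 2 + Real.sinh t ^ 2 / 2 ≤ Real.cosh t ^ 3 := by
    have : Real.sinh t ^ 2 = Real.cosh t ^ 2 - 1 := by linarith
    rw [this]
    nlinarith [mul_nonneg (sub_nonneg.2 hC) (sub_nonneg.2 hC), mul_nonneg (mul_nonneg (sub_nonneg.2 hC) (sub_nonneg.2 hC)) (sub_nonneg.2 hC)]
  calc t * (Real.cosh t ^ 2 + Real.sinh t ^ 2 / 2) ≤ Real.sinh t * Real.cosh t ^ 3 := by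
        apply mul_le_mul hS h3 (by positivity) (ht.le.trans hS)
    _ = _ := by ring

theorem g_aux (u v : ℝ) (hv : 0 < v) (huv : v < u) :
    v / (Real.sinh v * Real.cosh v) - u / (Real.sinh u * Real.cosh u)
      ≤ (u ^ 2 - v ^ 2) * (1 / Real.cosh v ^ 2 * (1 - 1 / (4 * Real.cosh v ^ 2))) := by
  set B := 1 / Real.cosh v ^ 2 * (1 - 1 / (4 * Real.cosh v ^ 2)) with hB
  have hd : ∀ t, 0 < t → HasDerivAt (fun t => t / (Real.sinh t * Real.cosh t) + B * t ^ 2)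
      ((Real.sinh t * Real.cosh t - t * (Real.cosh t ^ 2 + Real.sinh t ^ 2))
        / (Real.sinh t * Real.cosh t) ^ 2 + B * (2 * t)) t := by
    intro t ht
    have hS : 0 < Real.sinh t := Real.sinh_pos_iff.2 ht
    have hC := Real.cosh_pos t
    have h1 := (hasDerivAt_id t).div ((Real.hasDerivAt_sinh t).mul (Real.hasDerivAt_cosh t))
      (mul_pos hS hC).ne'
    have h2 := ((hasDerivAt_id t).pow 2).const_mul B
    refine (h1.add h2).congr_deriv ?_
    simp
    ring
  have hm : MonotoneOn (fun t => t / (Real.sinh t * Real.cosh t) + B * t ^ 2) (Set.Ici v) := by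
    apply monotoneOn_of_deriv_nonneg (convex_Ici v)
    · intro t ht
      exact (hd t (hv.trans_le ht)).continuousAt.continuousWithinAt
    · intro t ht
      rw [interior_Ici] at ht
      exact (hd t (hv.trans ht)).differentiableAt.differentiableWithinAt
    · intro t ht
      rw [interior_Ici] at ht
      have ht : v < t := ht
      have ht0 := hv.trans ht
      rw [(hd t ht0).deriv]
      have hS : 0 < Real.sinh t := Real.sinh_pos_iff.2 ht0
      have hC := Real.cosh_pos t
      have hCC : Real.cosh v ≤ Real.cosh t := by
        rw [Real.cosh_le_cosh, abs_of_pos hv, abs_of_pos ht0]; exact ht.le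
      have hBt : 1 / Real.cosh t ^ 2 * (1 - 1 / (4 * Real.cosh t ^ 2)) ≤ B := by
        have e1 : 1 / Real.cosh t ^ 2 ≤ 1 / Real.cosh v ^ 2 := by
          have := Real.cosh_pos v
          gcongr
        have e2 : 1 / Real.cosh v ^ 2 ≤ 1 := by
          rw [div_le_one (by have := Real.cosh_pos v; positivity)]
          nlinarith [Real.one_le_cosh v]
        have e3 : ∀ c : ℝ, 1 / (4 * Real.cosh c ^ 2) = 1 / Real.cosh c ^ 2 / 4 := by
          intro c; have := Real.cosh_pos c; field_simp
        rw [hB, e3, e3]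
        nlinarith
      have key := sc_aux t ht0
      have hsq := Real.cosh_sq t
      have h4 : 0 ≤ (Real.sinh t * Real.cosh t - t * (Real.cosh t ^ 2 + Real.sinh t ^ 2))
        / (Real.sinh t * Real.cosh t) ^ 2
          + 1 / Real.cosh t ^ 2 * (1 - 1 / (4 * Real.cosh t ^ 2)) * (2 * t) := by
        have : (Real.sinh t * Real.cosh t - t * (Real.cosh t ^ 2 + Real.sinh t ^ 2))
            / (Real.sinh t * Real.cosh t) ^ 2
          + 1 / Real.cosh t ^ 2 * (1 - 1 / (4 * Real.cosh t ^ 2)) * (2 * t)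
          = (Real.sinh t * Real.cosh t * Real.cosh t ^ 2
              - t * (Real.cosh t ^ 2 * (Real.cosh t ^ 2 - Real.sinh t ^ 2) + Real.sinh t ^ 2 / 2))
            / (Real.sinh t ^ 2 * Real.cosh t ^ 4) := by
          field_simp
          ring
        rw [this]
        apply div_nonneg _ (by positivity)
        have e : Real.cosh t ^ 2 - Real.sinh t ^ 2 = 1 := by linarith
        rw [e]; linarith
      nlinarith [mul_le_mul_of_nonneg_right hBt (by linarith : 0 ≤ 2 * t)]
  have := hm (Set.self_mem_Ici) (Set.mem_Ici.2 huv.le) huv.le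
  simp only at this
  linarith

theorem main_aux (u v : ℝ) (hv : 0 < v) (huv : v < u) :
    v * (1 - Real.tanh v ^ 2) * Real.tanh u - u * (1 - Real.tanh u ^ 2) * Real.tanh v
      ≤ Real.tanh u * Real.tanh v * ((u ^ 2 - v ^ 2) *
        ((1 - Real.tanh v ^ 2) * (3 / 4 + Real.tanh v ^ 2 / 4))) := by
  have h := g_aux u v hv huv
  have hT : ∀ t : ℝ, 1 / Real.cosh t ^ 2 = 1 - Real.tanh t ^ 2 := by
    intro t
    have := Real.cosh_pos t
    rw [Real.tanh_eq_sinh_div_cosh, div_pow, eq_sub_iff_add_eq, ← add_div, div_eq_one_iff_eq (by positivity)]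
    linarith [Real.cosh_sq t]
  have hg : ∀ t : ℝ, 0 < t → t / (Real.sinh t * Real.cosh t) * Real.tanh t
      = t * (1 - Real.tanh t ^ 2) := by
    intro t ht
    have h1 : 0 < Real.sinh t := Real.sinh_pos_iff.2 ht
    have := Real.cosh_pos t
    rw [← hT, Real.tanh_eq_sinh_div_cosh]
    field_simp
  have hp : ∀ t : ℝ, 0 < t → 0 < Real.tanh t := by
    intro t ht
    have h1 : 0 < Real.sinh t := Real.sinh_pos_iff.2 ht
    have := Real.cosh_pos t
    rw [Real.tanh_eq_sinh_div_cosh]; positivity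
  have e3 : 1 / (4 * Real.cosh v ^ 2) = 1 / Real.cosh v ^ 2 / 4 := by
    have := Real.cosh_pos v; field_simp
  rw [e3, hT] at h
  have hu := hv.trans huv
  rw [← hg v hv, ← hg u hu]
  have := mul_le_mul_of_nonneg_left h (mul_pos (hp u hu) (hp v hv)).le
  linarith

/-- For every `a ∈ (0, 0.45)`, the function `η(y,z) = H(ay)H(az)` satisfies the subsolution
inequality `-∂_y²η - ∂_z²η - (6/(y²-z²))(y∂_yη - z∂_zη) - η + η³ ≤ 0` in `{y > z > 0}`. -/
theorem stmt_19 : ∀ a : ℝ, 0 < a → a < 0.45 → ∀ y z : ℝ, 0 < z → z < y →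
    -(deriv (fun y1 => deriv (fun y2 => H (a * y2) * H (a * z)) y1) y)
      - deriv (fun z1 => deriv (fun z2 => H (a * y) * H (a * z2)) z1) z
      - (6 / (y ^ 2 - z ^ 2)) *
          (y * deriv (fun y2 => H (a * y2) * H (a * z)) y
            - z * deriv (fun z2 => H (a * y) * H (a * z2)) z)
      - H (a * y) * H (a * z) + (H (a * y) * H (a * z)) ^ 3 ≤ 0 := by
  intro a ha ha2 y z hz hzy
  simp only [mul_comm (H (a * y)) (H (a * _))]
  rw [deriv2_H_aux, deriv2_H_aux, ((hasDerivAt_H_aux a y).mul_const _).deriv,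
    ((hasDerivAt_H_aux a z).mul_const _).deriv]
  have hs : Real.sqrt 2 ^ 2 = 2 := Real.sq_sqrt (by norm_num)
  have hs0 : 0 < Real.sqrt 2 := by positivity
  obtain ⟨u, hu⟩ : ∃ u, u = a * y / Real.sqrt 2 := ⟨_, rfl⟩
  obtain ⟨v, hv⟩ : ∃ v, v = a * z / Real.sqrt 2 := ⟨_, rfl⟩
  have hv0 : 0 < v := by rw [hv]; positivity
  have huv : v < u := by rw [hu, hv]; gcongr
  have hm := main_aux u v hv0 huv
  have hHu : H (a * y) = Real.tanh u := by rw [hu, H]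
  have hHv : H (a * z) = Real.tanh v := by rw [hv, H]
  have hT : ∀ t : ℝ, 0 < t → 0 < Real.tanh t := by
    intro t ht
    have h1 : 0 < Real.sinh t := Real.sinh_pos_iff.2 ht
    have := Real.cosh_pos t
    rw [Real.tanh_eq_sinh_div_cosh]; positivity
  have hp0 := hT u (hv0.trans huv)
  have hq0 := hT v hv0
  have hp1 : Real.tanh u < 1 := Real.tanh_lt_one u
  have hpq : Real.tanh v ≤ Real.tanh u := by
    rw [Real.tanh_eq_sinh_div_cosh, Real.tanh_eq_sinh_div_cosh,
      div_le_div_iff₀ (Real.cosh_pos v) (Real.cosh_pos u)]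
    have := Real.sinh_sub u v
    have h2 : 0 < Real.sinh (u - v) := Real.sinh_pos_iff.2 (by linarith)
    linarith
  rw [hHu, hHv]
  generalize Real.tanh u = p at *
  generalize Real.tanh v = q at *
  have hyz : 0 < y ^ 2 - z ^ 2 := by nlinarith
  have hD : u ^ 2 - v ^ 2 = a ^ 2 * (y ^ 2 - z ^ 2) / 2 := by
    rw [hu, hv, div_pow, div_pow, hs]; ring
  have hE : -((6 / (y ^ 2 - z ^ 2)) * (y * (a / Real.sqrt 2 * (1 - p ^ 2) * q)
      - z * (a / Real.sqrt 2 * (1 - q ^ 2) * p)))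
      ≤ 3 * a ^ 2 * (p * q * ((1 - q ^ 2) * (3 / 4 + q ^ 2 / 4))) := by
    have e : y * (a / Real.sqrt 2 * (1 - p ^ 2) * q) - z * (a / Real.sqrt 2 * (1 - q ^ 2) * p)
        = u * (1 - p ^ 2) * q - v * (1 - q ^ 2) * p := by rw [hu, hv]; ring
    rw [e, ← mul_neg, div_mul_eq_mul_div, div_le_iff₀ hyz]
    rw [hD] at hm
    linarith
  have hA : a ^ 2 ≤ 81 / 400 := by norm_num at ha2; nlinarith
  have hP1 : p ^ 2 ≤ 1 := by nlinarith
  have hQP : q ^ 2 ≤ p ^ 2 := by nlinarith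
  have hQ0 : 0 ≤ q ^ 2 := sq_nonneg q
  have hfin : a ^ 2 * (2 - p ^ 2 - q ^ 2 + 3 * ((1 - q ^ 2) * (3 / 4 + q ^ 2 / 4)))
      - 1 + p ^ 2 * q ^ 2 ≤ 0 := by
    generalize p ^ 2 = P at *
    generalize q ^ 2 = Q at *
    have h0 : 0 ≤ 2 - P - Q + 3 * ((1 - Q) * (3 / 4 + Q / 4)) := by
      have : 0 ≤ (1 - Q) * (3 / 4 + Q / 4) := mul_nonneg (by linarith) (by linarith)
      linarith
    have h1 := mul_le_mul_of_nonneg_right hA h0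
    nlinarith [mul_nonneg (sub_nonneg.2 hQP) hQ0, mul_nonneg (sub_nonneg.2 hP1) hQ0,
      mul_nonneg (sub_nonneg.2 (hQP.trans hP1)) hQ0, mul_nonneg (sub_nonneg.2 hP1) (sub_nonneg.2 hQP)]
  have := mul_nonneg (mul_pos hp0 hq0).le (neg_nonneg.2 hfin)
  generalize (6 / (y ^ 2 - z ^ 2)) * (y * (a / Real.sqrt 2 * (1 - p ^ 2) * q)
      - z * (a / Real.sqrt 2 * (1 - q ^ 2) * p)) = E at *
  clear hm hD hHu hHv
  linarith
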